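/- arXiv:2506.16324 — 2 statements merged into one kernel-verified Lean document; each statement's English description precedes it below -/
import Mathlib

section
/- Let c ≥ 1, m ≥ 1, let Φ be a ℂ-linear map from M_{m·2^c}(ℂ) to itself (matrices indexed by pairs in Fin m × Fin 2^c), and let A, η ∈ M_m(ℂ). If Φ(A ⊗ₖ P) = η ⊗ₖ P for every PauliProd projector P on c qubits, then Φ(A ⊗ₖ M) = η ⊗ₖ M for every matrix M ∈ M_{2^c}(ℂ). -/
open Kronecker Matrix

/-- The six single-qubit Pauli eigenstates
`|0⟩, |1⟩, |+⟩, |−⟩, |R⟩, |L⟩` as vectors in `ℂ²`. -/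
noncomputable def pauliVec : Fin 6 → Fin 2 → ℂ
  | 0 => ![1, 0]
  | 1 => ![0, 1]
  | 2 => ![(Real.sqrt 2 : ℂ)⁻¹, (Real.sqrt 2 : ℂ)⁻¹]
  | 3 => ![(Real.sqrt 2 : ℂ)⁻¹, -(Real.sqrt 2 : ℂ)⁻¹]
  | 4 => ![(Real.sqrt 2 : ℂ)⁻¹, Complex.I * (Real.sqrt 2 : ℂ)⁻¹]
  | 5 => ![(Real.sqrt 2 : ℂ)⁻¹, -Complex.I * (Real.sqrt 2 : ℂ)⁻¹]

/-- The rank-one outer product `v v†` of a vector `v` with its conjugate. -/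
noncomputable def outerProj {n : ℕ} (v : Fin n → ℂ) : Matrix (Fin n) (Fin n) ℂ :=
  Matrix.vecMulVec v (star v)

/-- The `c`-fold Kronecker product `P₁ ⊗ₖ ⋯ ⊗ₖ P_c` of the Pauli-eigenstate projectors
selected by `f : Fin c → Fin 6`, as a matrix in `M_{2^c}(ℂ)` (the indices of `Fin (2^c)`
are identified with tuples of bits via `finFunctionFinEquiv`). -/
noncomputable def pauliProdProj (c : ℕ) (f : Fin c → Fin 6) :
    Matrix (Fin (2 ^ c)) (Fin (2 ^ c)) ℂ := fun i j =>
  ∏ k : Fin c,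
    outerProj (pauliVec (f k)) (finFunctionFinEquiv.symm i k) (finFunctionFinEquiv.symm j k)

/-- Every single-qubit matrix unit is a linear combination of Pauli-eigenstate projectors. -/
lemma exists_sum_outerProj_pauliVec_eq_single (a b : Fin 2) :
    ∃ w : Fin 6 → ℂ, ∑ p, w p • outerProj (pauliVec p) = Matrix.single a b 1 := by
  have hs : (Real.sqrt 2 : ℂ)⁻¹ * (Real.sqrt 2 : ℂ)⁻¹ = 1 / 2 := by
    rw [← mul_inv, ← Complex.ofReal_mul, Real.mul_self_sqrt (by norm_num)]
    norm_num
  have hI : Complex.I * Complex.I = -1 := Complex.I_mul_I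
  let w : Fin 2 → Fin 2 → Fin 6 → ℂ :=
    ![![![1, 0, 0, 0, 0, 0], ![0, 0, 1 / 2, -1 / 2, Complex.I / 2, -Complex.I / 2]],
      ![![0, 0, 1 / 2, -1 / 2, -Complex.I / 2, Complex.I / 2], ![0, 1, 0, 0, 0, 0]]]
  refine ⟨w a b, ?_⟩
  ext x y
  simp only [Matrix.sum_apply, Matrix.smul_apply, smul_eq_mul, outerProj,
    Matrix.vecMulVec_apply, Pi.star_apply, Matrix.single_apply]
  fin_cases a <;> fin_cases b <;> fin_cases x <;> fin_cases y <;>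
    simp [w, Fin.sum_univ_succ, pauliVec] <;>
    grind

/-- The Pauli-product projectors span the full matrix algebra. -/
lemma span_range_pauliProdProj (c : ℕ) :
    Submodule.span ℂ (Set.range (pauliProdProj c)) = ⊤ := by
  choose w hw using exists_sum_outerProj_pauliVec_eq_single
  have hunit (i j : Fin (2 ^ c)) : Matrix.single i j (1 : ℂ) =
      ∑ f : Fin c → Fin 6,
        (∏ k, w (finFunctionFinEquiv.symm i k) (finFunctionFinEquiv.symm j k) (f k)) •
          pauliProdProj c f := by
    ext x y
    have hfactor (k : Fin c) := congrFun (congrFun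
      (hw (finFunctionFinEquiv.symm i k) (finFunctionFinEquiv.symm j k))
      (finFunctionFinEquiv.symm x k)) (finFunctionFinEquiv.symm y k)
    simp only [Matrix.sum_apply, Matrix.smul_apply, smul_eq_mul] at hfactor ⊢
    simp only [pauliProdProj, ← Finset.prod_mul_distrib]
    rw [← Fintype.piFinset_univ, ← Finset.prod_univ_sum (fun _ => Finset.univ)
      (fun k p => w (finFunctionFinEquiv.symm i k) (finFunctionFinEquiv.symm j k) p *
        outerProj (pauliVec p) (finFunctionFinEquiv.symm x k) (finFunctionFinEquiv.symm y k))]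
    have hindex (i x : Fin (2 ^ c)) :
        (∀ k, finFunctionFinEquiv.symm i k = finFunctionFinEquiv.symm x k) ↔ i = x := by
      rw [← funext_iff, EmbeddingLike.apply_eq_iff_eq]
    simp only [hfactor, Matrix.single_apply, Finset.prod_ite_zero, Finset.prod_const_one,
      Finset.mem_univ, forall_const, forall_and, hindex]
  refine eq_top_iff.2 fun M _ => ?_
  rw [Matrix.matrix_eq_sum_single M]
  refine Submodule.sum_mem _ fun i _ => Submodule.sum_mem _ fun j _ => ?_
  rw [← mul_one (M i j), ← smul_eq_mul, ← Matrix.smul_single, hunit]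
  exact Submodule.smul_mem _ _ <| Submodule.sum_mem _ fun f _ =>
    Submodule.smul_mem _ _ <| Submodule.subset_span ⟨f, rfl⟩

/-- If a `ℂ`-linear map `Φ` on `M_{m·2^c}(ℂ)` satisfies `Φ(A ⊗ₖ P) = η ⊗ₖ P`
for every PauliProd projector `P` on `c` qubits, then `Φ(A ⊗ₖ M) = η ⊗ₖ M` for every
matrix `M ∈ M_{2^c}(ℂ)`. -/
theorem catalytic_on_pauliProd_implies_all (c m : ℕ) (hc : 1 ≤ c) (hm : 1 ≤ m)
    (Φ : Matrix (Fin m × Fin (2 ^ c)) (Fin m × Fin (2 ^ c)) ℂ →ₗ[ℂ]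
         Matrix (Fin m × Fin (2 ^ c)) (Fin m × Fin (2 ^ c)) ℂ)
    (A η : Matrix (Fin m) (Fin m) ℂ)
    (hP : ∀ f : Fin c → Fin 6,
      Φ (A ⊗ₖ pauliProdProj c f) = η ⊗ₖ pauliProdProj c f) :
    ∀ M : Matrix (Fin (2 ^ c)) (Fin (2 ^ c)) ℂ, Φ (A ⊗ₖ M) = η ⊗ₖ M := by
  intro M
  have hM : M ∈ Submodule.span ℂ (Set.range (pauliProdProj c)) := by
    rw [span_range_pauliProdProj]
    trivial
  induction hM using Submodule.span_induction with
  | mem M hM =>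
    obtain ⟨f, rfl⟩ := hM
    exact hP f
  | zero => simp
  | add M N _ _ hM hN => rw [Matrix.kronecker_add, Matrix.kronecker_add, map_add, hM, hN]
  | smul a M _ hM => rw [Matrix.kronecker_smul, Matrix.kronecker_smul, map_smul, hM]
end

section
/- Let E be a normed vector space over ℝ, let S ⊆ E be a convex set, let T be any type, and let f : S → T be a function with the property that for all x, y ∈ S, if f(x) ≠ f(y) then ‖x − y‖ = 1. Then f is constant on S, i.e., f(x) = f(y) for all x, y ∈ S. -/
/-- Let `E` be a normed vector space over `ℝ`, `S ⊆ E` a convex set, `T`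
any type, and `f : S → T` a function such that whenever `f x ≠ f y` we have
`‖x − y‖ = 1`. Then `f` is constant on `S`. -/
theorem constant_of_norm_one_separation
    {E : Type*} [NormedAddCommGroup E] [NormedSpace ℝ E]
    (S : Set E) (hS : Convex ℝ S) (T : Type*) (f : S → T)
    (h : ∀ x y : S, f x ≠ f y → ‖(x : E) - (y : E)‖ = 1) :
    ∀ x y : S, f x = f y := by
  intro x y
  by_contra hxy
  have hdist : dist (x : E) y = 1 := by rw [dist_eq_norm]; exact h x y hxy
  let m : S := ⟨midpoint ℝ (x : E) y, hS.midpoint_mem x.2 y.2⟩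
  have hxm : f x = f m := by
    by_contra hne
    have h₁ : dist (x : E) (midpoint ℝ (x : E) y) = 1 := by
      rw [dist_eq_norm]; exact h x m hne
    rw [dist_left_midpoint, hdist] at h₁
    norm_num at h₁
  have hmy : f m = f y := by
    by_contra hne
    have h₁ : dist (midpoint ℝ (x : E) y) (y : E) = 1 := by
      rw [dist_eq_norm]; exact h m y hne
    rw [dist_midpoint_right, hdist] at h₁
    norm_num at h₁
  exact hxy (hxm.trans hmy)
end
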